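/- arXiv:2312.00144 — 2 statements merged into one kernel-verified Lean document; each statement's English description precedes it below -/
import Mathlib

section
/- Let F be a field, and let a, b ∈ F with a not a cube in F and b ≠ 0. Suppose there exist u, v, w, t ∈ F, not all zero, such that a·u³ + b·v³ + a·b·w³ + t³ = 0. Then b is a norm from the pure cubic extension L = F[X]/(X³ − a): there exists β ∈ L with N_{L/F}(β) = b. (Explicitly, one may take β = −(t + α·u)/(v + α·w), where α ∈ L is the class of X.) -/
open Polynomial

lemma norm_aux_sub (F : Type*) [Field F] (a x : F) :
    Algebra.norm F (algebraMap F (AdjoinRoot (X ^ 3 - C a)) x - AdjoinRoot.root (X ^ 3 - C a))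
      = x ^ 3 - a := by
  have hm : (X ^ 3 - C a : F[X]).Monic := monic_X_pow_sub_C a (by norm_num)
  have hg : (AdjoinRoot.powerBasis hm.ne_zero).gen = AdjoinRoot.root (X ^ 3 - C a) := rfl
  have h1 := charpoly_leftMulMatrix (AdjoinRoot.powerBasis hm.ne_zero)
  rw [AdjoinRoot.minpoly_powerBasis_gen_of_monic hm] at h1
  rw [Algebra.norm_eq_matrix_det (AdjoinRoot.powerBasis hm.ne_zero).basis, map_sub,
    AlgHom.commutes, ← hg]
  have h2 := congrArg (eval x) h1
  rw [Matrix.eval_charpoly] at h2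
  rw [eval_sub, eval_pow, eval_X, eval_C] at h2
  exact h2

lemma norm_aux_C (F : Type*) [Field F] (a x : F) :
    Algebra.norm F (algebraMap F (AdjoinRoot (X ^ 3 - C a)) x) = x ^ 3 := by
  have hm : (X ^ 3 - C a : F[X]).Monic := monic_X_pow_sub_C a (by norm_num)
  rw [Algebra.norm_algebraMap, (AdjoinRoot.powerBasis hm.ne_zero).finrank,
    AdjoinRoot.powerBasis_dim, natDegree_X_pow_sub_C]

lemma norm_aux (F : Type*) [Field F] (a x y : F) :
    Algebra.norm F (algebraMap F (AdjoinRoot (X ^ 3 - C a)) x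
      + AdjoinRoot.root (X ^ 3 - C a) * algebraMap F _ y) = x ^ 3 + a * y ^ 3 := by
  by_cases hy : y = 0
  · simp only [hy, map_zero, mul_zero, add_zero]
    rw [norm_aux_C]; ring
  · have : algebraMap F (AdjoinRoot (X ^ 3 - C a)) x
      + AdjoinRoot.root (X ^ 3 - C a) * algebraMap F _ y
      = algebraMap F (AdjoinRoot (X ^ 3 - C a)) (-y) *
        (algebraMap F (AdjoinRoot (X ^ 3 - C a)) (-x / y) - AdjoinRoot.root (X ^ 3 - C a)) := by
      rw [mul_sub, ← map_mul, show -y * (-x / y) = x by field_simp, map_neg]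
      ring
    rw [this, map_mul, norm_aux_C, norm_aux_sub]
    field_simp
    ring

/-- If `a` is not a cube in a field `F`, `b ≠ 0`, and the cubic surface
`a·u³ + b·v³ + a·b·w³ + t³ = 0` has a nontrivial `F`-point, then `b` is a norm
from the pure cubic extension `L = F[X]/(X³ - a)`. -/
theorem norm_of_point_on_cubic_surface (F : Type*) [Field F] (a b : F)
    (ha : ¬∃ c : F, c ^ 3 = a) (hb : b ≠ 0)
    (u v w t : F) (hnt : ¬(u = 0 ∧ v = 0 ∧ w = 0 ∧ t = 0))
    (heq : a * u ^ 3 + b * v ^ 3 + a * b * w ^ 3 + t ^ 3 = 0) :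
    ∃ β : AdjoinRoot (X ^ 3 - C a), Algebra.norm F β = b := by
  have key : ∀ x y : F, x ^ 3 + a * y ^ 3 = 0 → x = 0 ∧ y = 0 := by
    intro x y h
    have hy : y = 0 := by
      by_contra hy
      refine ha ⟨-x / y, ?_⟩
      field_simp
      linear_combination -h
    subst hy
    exact ⟨by simpa using h, rfl⟩
  have hn : v ^ 3 + a * w ^ 3 ≠ 0 := by
    intro h
    obtain ⟨hv, hw⟩ := key v w h
    obtain ⟨ht, hu⟩ := key t u (by linear_combination heq - b * h)
    exact hnt ⟨hu, hv, hw, ht⟩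
  refine ⟨algebraMap F _ (-(v ^ 3 + a * w ^ 3)⁻¹) *
    (algebraMap F _ t + AdjoinRoot.root (X ^ 3 - C a) * algebraMap F _ u) *
    (algebraMap F _ v + AdjoinRoot.root (X ^ 3 - C a) * algebraMap F _ w) ^ 2, ?_⟩
  rw [map_mul, map_mul, map_pow, norm_aux_C, norm_aux, norm_aux]
  have h : t ^ 3 + a * u ^ 3 = -b * (v ^ 3 + a * w ^ 3) := by linear_combination heq
  rw [h]
  generalize v ^ 3 + a * w ^ 3 = n at hn
  field_simp
end

section
/- Let k be a field with char k ≠ 2 and char k ≠ 3, and let K = k(s, t) be the field of rational functions in two variables over k. Let f̃ = (s + t + 1)³ − 6st ∈ k[s, t] ⊂ K. Then none of the six elements s, t², s·t², f̃, s·f̃, t²·f̃ is a cube in K. -/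
open MvPolynomial

lemma not_cube_aux {k : Type*} [Field k] (p : MvPolynomial (Fin 2) k)
    (g : Fin 2 → Polynomial k) (d : ℕ) (hd : (aeval g p).natDegree = d) (hd3 : ¬ 3 ∣ d)
    (h : FractionRing (MvPolynomial (Fin 2) k))
    (hh : h ^ 3 = algebraMap (MvPolynomial (Fin 2) k) _ p) : False := by
  have hi : IsIntegral (MvPolynomial (Fin 2) k) h := by
    apply IsIntegral.of_pow (n := 3) (by norm_num)
    rw [hh]
    exact isIntegral_algebraMap
  obtain ⟨q, rfl⟩ := IsIntegrallyClosed.isIntegral_iff.mp hi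
  rw [← map_pow] at hh
  have hq : q ^ 3 = p := IsFractionRing.injective _ _ hh
  apply hd3
  rw [← hd, ← hq, map_pow, Polynomial.natDegree_pow]
  exact dvd_mul_right _ _

/-- Let `k` be a field of characteristic `≠ 2, 3` and `K = k(s, t)` the field
of rational functions in two variables. With `f̃ = (s + t + 1)³ − 6st`, none of
the six elements `s, t², s·t², f̃, s·f̃, t²·f̃` is a cube in `K`. -/
theorem not_cube_six_elements (k : Type*) [Field k]
    (h2 : ringChar k ≠ 2) (h3 : ringChar k ≠ 3) :
    let K := FractionRing (MvPolynomial (Fin 2) k)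
    let s : K := algebraMap (MvPolynomial (Fin 2) k) K (X 0)
    let t : K := algebraMap (MvPolynomial (Fin 2) k) K (X 1)
    let f : K := (s + t + 1) ^ 3 - 6 * (s * t)
    (¬∃ h : K, h ^ 3 = s) ∧ (¬∃ h : K, h ^ 3 = t ^ 2) ∧
    (¬∃ h : K, h ^ 3 = s * t ^ 2) ∧ (¬∃ h : K, h ^ 3 = f) ∧
    (¬∃ h : K, h ^ 3 = s * f) ∧ (¬∃ h : K, h ^ 3 = t ^ 2 * f) := by
  intro K s t f
  have h6 : (6 : k) ≠ 0 := by
    have e2 : (2 : k) ≠ 0 := Ring.two_ne_zero h2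
    have e3 : (3 : k) ≠ 0 := by
      intro h
      have := (ringChar.spec k 3).mp (by exact_mod_cast h)
      rcases (Nat.dvd_prime Nat.prime_three).mp this with h | h
      · have := (ringChar.spec k 1).mpr (by rw [h])
        simp at this
      · exact h3 h
    have : (6 : k) = 2 * 3 := by norm_num
    rw [this]
    exact mul_ne_zero e2 e3
  let F : MvPolynomial (Fin 2) k := (X 0 + X 1 + 1) ^ 3 - 6 * (X 0 * X 1)
  have hF : f = algebraMap _ K F := by 
    simp [F, f, s, t]
    exact (map_ofNat (algebraMap (MvPolynomial (Fin 2) k) (FractionRing (MvPolynomial (Fin 2) k))) 6).symm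
  have a6 : ∀ g : Fin 2 → Polynomial k, aeval g F
      = (g 0 + g 1 + 1) ^ 3 - 6 * (g 0 * g 1) := by
    intro g
    simp [F]
  refine ⟨?_, ?_, ?_, ?_, ?_, ?_⟩ <;> rintro ⟨h, hh⟩
  · exact not_cube_aux (X 0) ![Polynomial.X, 1] 1 (by simp) (by norm_num) h hh
  · exact not_cube_aux (X 1 ^ 2) ![1, Polynomial.X] 2 (by simp) (by norm_num) h
      (by rw [hh]; simp [t]; rfl)
  · exact not_cube_aux (X 0 * X 1 ^ 2) ![Polynomial.X, 1] 1 (by simp) (by norm_num) h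
      (by rw [hh]; simp [s, t]; rfl)
  · refine not_cube_aux F ![Polynomial.X, -Polynomial.X - 1] 2 ?_ (by norm_num) h
      (by rw [hh, hF])
    rw [a6]
    have : (((![Polynomial.X, -Polynomial.X - 1] : Fin 2 → Polynomial k) 0
        + (![Polynomial.X, -Polynomial.X - 1] : Fin 2 → Polynomial k) 1 + 1) ^ 3
        - 6 * ((![Polynomial.X, -Polynomial.X - 1] : Fin 2 → Polynomial k) 0
          * (![Polynomial.X, -Polynomial.X - 1] : Fin 2 → Polynomial k) 1))
        = Polynomial.C 6 * Polynomial.X ^ 2 + Polynomial.C 6 * Polynomial.X + Polynomial.C 0 := by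
      have : (Polynomial.C 6 : Polynomial k) = 6 := rfl
      simp [this]
      ring
    rw [this]
    exact Polynomial.natDegree_quadratic h6
  · refine not_cube_aux (X 0 * F) ![Polynomial.X, 0] 4 ?_ (by norm_num) h
      (by rw [hh, hF, map_mul])
    rw [map_mul, a6]
    simp only [aeval_X, Matrix.cons_val_zero, Matrix.cons_val_one]
    have : (Polynomial.X * ((Polynomial.X + 0 + 1) ^ 3 - 6 * (Polynomial.X * 0)) : Polynomial k)
      = Polynomial.X * (Polynomial.X + Polynomial.C 1) ^ 3 := by simp
    rw [this]
    rw [Polynomial.Monic.natDegree_mul Polynomial.monic_X ((Polynomial.monic_X_add_C 1).pow 3),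
      Polynomial.natDegree_pow, Polynomial.natDegree_X_add_C, Polynomial.natDegree_X]
  · refine not_cube_aux (X 1 ^ 2 * F) ![0, Polynomial.X] 5 ?_ (by norm_num) h
      (by rw [hh, hF, map_mul, map_pow])
    rw [map_mul, a6]
    simp only [map_pow, aeval_X, Matrix.cons_val_zero, Matrix.cons_val_one]
    have : (Polynomial.X ^ 2 * ((0 + Polynomial.X + 1) ^ 3 - 6 * (0 * Polynomial.X)) : Polynomial k)
      = Polynomial.X ^ 2 * (Polynomial.X + Polynomial.C 1) ^ 3 := by simp
    rw [this]
    rw [Polynomial.Monic.natDegree_mul (Polynomial.monic_X.pow 2)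
      ((Polynomial.monic_X_add_C 1).pow 3),
      Polynomial.natDegree_pow, Polynomial.natDegree_pow, Polynomial.natDegree_X_add_C,
      Polynomial.natDegree_X]
end
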